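/- Let σ be a permutation of [n] with σ(0) = 0 and let γ be a multi-index of length k and dimension ≤ n. Then there exists a permutation σ' of [n−k] with σ'(0) = 0 such that u_γ ∘ σ = σ' ∘ u_{σ^{−1}(γ)} as maps [n] → [n−k], where σ^{−1}(γ) denotes the multi-index whose underlying set is the preimage { p : σ(p) ∈ γ } (a subset of {1,…,n} since σ(0) = 0, rearranged in increasing order). -/

import Mathlib

/-- The elementary coface `d_i^{(n+1)} : [n] → [n+1]` (monotonic injection omitting `i`):
`k ↦ k` for `k < i` and `k ↦ k+1` for `k ≥ i`. -/
def dMap (n i : ℕ) : Fin (n + 1) → Fin (n + 2) :=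
  fun k => if (k : ℕ) < i then ⟨k, by omega⟩ else ⟨(k : ℕ) + 1, by omega⟩

/-- The elementary quasi-codegeneracy `u_i^{(n)} : [n+1] → [n]`:
`u_i 0 = u_i i = 0`, `u_i k = k` for `1 ≤ k ≤ i-1`, and `u_i k = k-1` for `k > i`. -/
def uMap (n i : ℕ) : Fin (n + 2) → Fin (n + 1) :=
  fun k => if (k : ℕ) = 0 ∨ (k : ℕ) = i then 0
    else if h : (k : ℕ) < i ∧ (k : ℕ) < n + 1 then ⟨k, h.2⟩
    else ⟨(k : ℕ) - 1, by omega⟩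

/-- A function `f : [n] → [m]` is quasi-monotonic if `f 0 = 0` and `f` is strictly
monotonic outside the preimage of `0`. -/
def QuasiMonotonic {n m : ℕ} (f : Fin (n + 1) → Fin (m + 1)) : Prop :=
  f 0 = 0 ∧ ∀ p q : Fin (n + 1), p < q → f p ≠ 0 → f q ≠ 0 → f p < f q

/-- A multi-index of dimension `≤ n`: a strictly increasing sequence of indices
`i_1 < … < i_k` with `1 ≤ i_p ≤ n` for all `p` (its length is `α.length`). -/
def IsMultiIndex (n : ℕ) (α : List ℕ) : Prop :=
  List.Chain' (· < ·) α ∧ ∀ i ∈ α, 1 ≤ i ∧ i ≤ n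

/-- The quasi-codegeneracy `u_α = u_{i_1} ∘ u_{i_2} ∘ ⋯ ∘ u_{i_k} : [n] → [n-k]`
associated to a multi-index `α = (i_1, …, i_k)`; each elementary factor is taken at the
appropriate dimension (`u_{i_k}` is applied first, at the highest dimension). -/
def uComp (n : ℕ) : (α : List ℕ) → α.length ≤ n → Fin (n + 1) → Fin (n - α.length + 1)
  | [], _ => fun k => k
  | i :: rest, h => fun k =>
      Fin.cast (by simp only [List.length_cons] at h ⊢; omega)
        (uMap (n - rest.length - 1) i
          (Fin.cast (by simp only [List.length_cons] at h; omega)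
            (uComp n rest (by simp only [List.length_cons] at h; omega) k)))

/-- The coface `d_α = d_{i_k} ∘ d_{i_{k-1}} ∘ ⋯ ∘ d_{i_1} : [n-k] → [n]`
associated to a multi-index `α = (i_1, …, i_k)`; each elementary factor is taken at the
appropriate dimension (`d_{i_1}` is applied first, at the lowest dimension). -/
def dComp (n : ℕ) : (α : List ℕ) → α.length ≤ n → Fin (n - α.length + 1) → Fin (n + 1)
  | [], _ => fun k => k
  | i :: rest, h => fun k =>
      dComp n rest (by simp only [List.length_cons] at h; omega)
        (Fin.cast (by simp only [List.length_cons] at h; omega)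
          (dMap (n - rest.length - 1) i
            (Fin.cast (by simp only [List.length_cons] at h ⊢; omega) k)))

theorem uMap_val (n i : ℕ) (hi : i ≤ n + 1) (k : Fin (n + 2)) :
    ((uMap n i k : Fin (n + 1)) : ℕ) =
      if (k : ℕ) = 0 ∨ (k : ℕ) = i then 0 else if (k : ℕ) < i then (k : ℕ) else (k : ℕ) - 1 := by
  unfold uMap
  split_ifs <;> simp <;> omega

theorem uComp_lt (n : ℕ) : ∀ (α : List ℕ) (h : α.length ≤ n) (x : Fin (n + 1)),
    IsMultiIndex n α → (∀ j ∈ α, (x : ℕ) < j) → (uComp n α h x : ℕ) = x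
  | [], _, _, _, _ => rfl
  | i :: rest, h, x, hm, hx => by
    have hm' : IsMultiIndex n rest :=
      ⟨(List.isChain_cons.1 hm.1).2, fun j hj => hm.2 j (List.mem_cons_of_mem _ hj)⟩
    have h' : rest.length ≤ n := by simp only [List.length_cons] at h; omega
    have hlt : ∀ j ∈ rest, i < j := by
      have := List.isChain_iff_pairwise.1 hm.1
      exact (List.pairwise_cons.1 this).1
    have e := uComp_lt n rest h' x hm' (fun j hj => hx j (List.mem_cons_of_mem _ hj))
    have hi := hm.2 i List.mem_cons_self
    have e2 := uComp_lt n rest h' ⟨i, by omega⟩ hm' hlt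
    have b := (uComp n rest h' ⟨i, by omega⟩).2
    have hxi := hx i List.mem_cons_self
    simp only [List.length_cons] at h
    simp only [uComp, Fin.val_cast]
    rw [uMap_val _ _ (by simp only at e2; omega)]
    simp only [Fin.val_cast, e]
    split_ifs <;> omega

theorem uComp_ker (n : ℕ) : ∀ (α : List ℕ) (h : α.length ≤ n),
    IsMultiIndex n α →
    (∀ x y, uComp n α h x = uComp n α h y ↔
      x = y ∨ (((x : ℕ) = 0 ∨ (x : ℕ) ∈ α) ∧ ((y : ℕ) = 0 ∨ (y : ℕ) ∈ α))) ∧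
    Function.Surjective (uComp n α h) ∧ uComp n α h 0 = 0
  | [], _, _ => by
    refine ⟨fun x y => ?_, fun x => ⟨x, rfl⟩, rfl⟩
    simp only [uComp, List.not_mem_nil, or_false]
    constructor
    · exact Or.inl
    · rintro (h | h)
      · exact h
      · ext; omega
  | i :: rest, h, hm => by
    have hm' : IsMultiIndex n rest :=
      ⟨(List.isChain_cons.1 hm.1).2, fun j hj => hm.2 j (List.mem_cons_of_mem _ hj)⟩
    have h' : rest.length ≤ n := by simp only [List.length_cons] at h; omega
    have hlt : ∀ j ∈ rest, i < j := by
      have := List.isChain_iff_pairwise.1 hm.1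
      exact (List.pairwise_cons.1 this).1
    have hi := hm.2 i List.mem_cons_self
    have e2 := uComp_lt n rest h' ⟨i, by omega⟩ hm' hlt
    have b := (uComp n rest h' ⟨i, by omega⟩).2
    obtain ⟨hk, hs, h0⟩ := uComp_ker n rest h' hm'
    have hl := h
    simp only [List.length_cons] at hl
    have hb : i ≤ n - rest.length - 1 + 1 := by simp only at e2; omega
    have hir : i ∉ rest := fun hh => lt_irrefl _ (hlt i hh)
    have k0 : ∀ x, (uComp n rest h' x : ℕ) = 0 ↔ ((x : ℕ) = 0 ∨ (x : ℕ) ∈ rest) := by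
      intro x
      have := hk x 0
      rw [h0, Fin.ext_iff, Fin.ext_iff] at this
      simp only [Fin.val_zero, true_or, and_true] at this
      rw [this]; tauto
    have ki : ∀ x, (uComp n rest h' x : ℕ) = i ↔ (x : ℕ) = i := by
      intro x
      have := hk x ⟨i, by omega⟩
      rw [Fin.ext_iff, e2, Fin.ext_iff] at this
      simp only [hir, or_false] at this
      rw [this]
      constructor
      · rintro (h | h)
        · exact h
        · omega
      · exact Or.inl
    have val : ∀ x, (uComp n (i :: rest) h x : ℕ) =
        if (uComp n rest h' x : ℕ) = 0 ∨ (uComp n rest h' x : ℕ) = i then 0 else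
        if (uComp n rest h' x : ℕ) < i then (uComp n rest h' x : ℕ)
        else (uComp n rest h' x : ℕ) - 1 := by
      intro x
      simp only [uComp, Fin.val_cast]
      rw [uMap_val _ _ hb]
      simp only [Fin.val_cast]
    refine ⟨fun x y => ?_, fun z => ?_, ?_⟩
    · have kx := k0 x
      have ky := k0 y
      have ix := ki x
      have iy := ki y
      have kxy := hk x y
      rw [Fin.ext_iff] at kxy
      rw [Fin.ext_iff, val, val]
      simp only [List.mem_cons]
      have A : ((x : ℕ) = 0 ∨ (x : ℕ) = i ∨ (x : ℕ) ∈ rest) ↔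
        ((uComp n rest h' x : ℕ) = 0 ∨ (uComp n rest h' x : ℕ) = i) := by rw [kx, ix, or_assoc, or_comm (a := (x : ℕ) = i)]
      have B : ((y : ℕ) = 0 ∨ (y : ℕ) = i ∨ (y : ℕ) ∈ rest) ↔
        ((uComp n rest h' y : ℕ) = 0 ∨ (uComp n rest h' y : ℕ) = i) := by rw [ky, iy, or_assoc, or_comm (a := (y : ℕ) = i)]
      rw [A, B]
      rw [← kx, ← ky] at kxy
      clear A B kx ky ix iy val ki k0
      generalize (uComp n rest h' x : ℕ) = a at *
      generalize (uComp n rest h' y : ℕ) = c at *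
      by_cases hxy : x = y
      · have : a = c := kxy.2 (Or.inl hxy)
        simp [hxy, this]
      · simp only [hxy, false_or] at kxy ⊢
        split_ifs <;> omega
    · have hz := z.2
      simp only [List.length_cons] at hz
      by_cases hz0 : (z : ℕ) = 0
      · refine ⟨0, ?_⟩
        rw [Fin.ext_iff, val, h0]
        simp [hz0]
      · by_cases hzi : (z : ℕ) < i
        · obtain ⟨x, hx⟩ := hs ⟨z, by omega⟩
          refine ⟨x, ?_⟩
          rw [Fin.ext_iff, val, hx]
          simp only
          split_ifs <;> omega
        · obtain ⟨x, hx⟩ := hs ⟨z + 1, by omega⟩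
          have hv : (uComp n rest h' x : ℕ) = z + 1 := by rw [hx]
          refine ⟨x, ?_⟩
          rw [Fin.ext_iff, val, hv]
          rw [if_neg (by omega), if_neg (by omega)]
          omega
    · rw [Fin.ext_iff, val, h0]
      simp

/-- for a permutation `σ` of `[n]` fixing `0` and a multi-index `γ` of
length `k` and dimension `≤ n`, there is a permutation `σ'` of `[n-k]` fixing `0`
with `u_γ ∘ σ = σ' ∘ u_{σ⁻¹(γ)}`.  Here `γ'` is the multi-index `σ⁻¹(γ)` whose
underlying set is `{p | σ p ∈ γ}` (a subset of `{1, …, n}` since `σ 0 = 0`,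
with indices in increasing order). -/
theorem perm_comp_uComp (n : ℕ) (σ : Equiv.Perm (Fin (n + 1))) (hσ0 : σ 0 = 0)
    (γ : List ℕ) (hmi : IsMultiIndex n γ) (hγl : γ.length ≤ n)
    (γ' : List ℕ) (hmi' : IsMultiIndex n γ') (hγ'l : γ'.length ≤ n)
    (hlen : γ'.length = γ.length)
    (hmem : ∀ p : Fin (n + 1), (p : ℕ) ∈ γ' ↔ ((σ p : ℕ) ∈ γ)) :
    ∃ σ' : Equiv.Perm (Fin (n - γ.length + 1)), σ' 0 = 0 ∧
      uComp n γ hγl ∘ σ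
        = σ' ∘ (fun x : Fin (n + 1) => Fin.cast (by omega) (uComp n γ' hγ'l x)) := by
  obtain ⟨k1, s1, z1⟩ := uComp_ker n γ hγl hmi
  obtain ⟨k2, s2, z2⟩ := uComp_ker n γ' hγ'l hmi'
  have hc : n - γ'.length + 1 = n - γ.length + 1 := by omega
  let g : Fin (n + 1) → Fin (n - γ.length + 1) := fun x => Fin.cast hc (uComp n γ' hγ'l x)
  have gs : Function.Surjective g := by
    intro z
    obtain ⟨x, hx⟩ := s2 (Fin.cast hc.symm z)
    exact ⟨x, by simp [g, hx]⟩
  have zz : ∀ x : Fin (n + 1), ((σ x : Fin (n + 1)) : ℕ) = 0 ↔ (x : ℕ) = 0 := by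
    intro x
    have : σ x = 0 ↔ x = 0 := by
      constructor
      · intro h; exact σ.injective (h.trans hσ0.symm)
      · intro h; rw [h, hσ0]
    rw [Fin.ext_iff, Fin.ext_iff] at this
    exact this
  have key : ∀ x y, uComp n γ hγl (σ x) = uComp n γ hγl (σ y) ↔ g x = g y := by
    intro x y
    have : g x = g y ↔ uComp n γ' hγ'l x = uComp n γ' hγ'l y := by
      simp [g, Fin.ext_iff]
    rw [this, k1, k2, zz, zz, hmem, hmem, σ.injective.eq_iff]
  let f : Fin (n - γ.length + 1) → Fin (n - γ.length + 1) :=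
    fun z => uComp n γ hγl (σ (Function.surjInv gs z))
  have fi : Function.Injective f := by
    intro a b hab
    have := (key _ _).1 hab
    rwa [Function.surjInv_eq gs, Function.surjInv_eq gs] at this
  have fg : ∀ x, f (g x) = uComp n γ hγl (σ x) := by
    intro x
    exact (key _ _).2 (Function.surjInv_eq gs (g x))
  refine ⟨Equiv.ofBijective f (Finite.injective_iff_bijective.1 fi), ?_, ?_⟩
  · have h0 : g 0 = 0 := by simp [g, z2]
    have := fg 0
    rw [h0, hσ0, z1] at this
    exact this
  · funext x
    exact (fg x).symm
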